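/- Let k : I × I → ℝ be a C² symmetric positive semi-definite kernel on an interval I ⊆ ℝ. Then for any finite points t_1,...,t_n ∈ I, the 2n × 2n matrix with blocks cov-entries K[(i,j)] formed by k(t_i,t_j), ∂k/∂y(t_i,t_j), ∂k/∂x(t_i,t_j), and ∂²k/∂x∂y(t_i,t_j) (i.e., the Gram matrix of the pairs (z_{t_i}, z'_{t_i}) prescribed for a derivative Gaussian process) is symmetric positive semi-definite. -/

import Mathlib

open Matrix Filter Topology

lemma aux_unique {I : Set ℝ} (hI : I.OrdConnected) (hInt : I.Nontrivial) : UniqueDiffOn ℝ I := by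
  apply uniqueDiffOn_convex hI.convex
  obtain ⟨a, ha, b, hb, hab⟩ := hInt
  rcases lt_or_gt_of_ne hab with h | h
  · exact (Set.nonempty_Ioo.2 h).mono
      (interior_maximal (Set.Ioo_subset_Icc_self.trans (hI.out ha hb)) isOpen_Ioo)
  · exact (Set.nonempty_Ioo.2 h).mono
      (interior_maximal (Set.Ioo_subset_Icc_self.trans (hI.out hb ha)) isOpen_Ioo)

lemma aux_mvt {I : Set ℝ} (hI : I.OrdConnected) {g g' : ℝ → ℝ}
    (hg : ∀ x ∈ I, HasDerivWithinAt g (g' x) I x) {a b : ℝ} (ha : a ∈ I) (hb : b ∈ I)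
    (hab : a ≠ b) : ∃ c ∈ Set.uIcc a b, g' c * (b - a) = g b - g a := by
  have key : ∀ a b : ℝ, a ∈ I → b ∈ I → a < b →
      ∃ c ∈ Set.uIcc a b, g' c * (b - a) = g b - g a := by
    intro a b ha hb h
    have hsub : Set.Icc a b ⊆ I := hI.out ha hb
    obtain ⟨c, hc, hc'⟩ := exists_hasDerivAt_eq_slope g g' h
      (fun x hx => ((hg x (hsub hx)).continuousWithinAt).mono hsub)
      (fun x hx => (hg x (hsub (Set.Ioo_subset_Icc_self hx))).hasDerivAt
        (mem_of_superset (Icc_mem_nhds hx.1 hx.2) hsub))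
    refine ⟨c, Set.Icc_subset_uIcc (Set.Ioo_subset_Icc_self hc), ?_⟩
    rw [hc', div_mul_cancel₀ _ (sub_pos.2 h).ne']
  rcases lt_or_gt_of_ne hab with h | h
  · exact key a b ha hb h
  · obtain ⟨c, hc, hc'⟩ := key b a hb ha h
    exact ⟨c, by rwa [Set.uIcc_comm], by linarith⟩

lemma aux_px {I : Set ℝ} {f : ℝ × ℝ → ℝ} {x y : ℝ} (hx : x ∈ I) (hy : y ∈ I)
    (hf : DifferentiableOn ℝ f (I ×ˢ I)) :
    HasDerivWithinAt (fun x => f (x, y)) (fderivWithin ℝ f (I ×ˢ I) (x, y) (1, 0)) I x := by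
  have h := (hf (x, y) (Set.mk_mem_prod hx hy)).hasFDerivWithinAt
  have h2 : HasDerivWithinAt (fun x : ℝ => (x, y)) ((1 : ℝ), (0 : ℝ)) I x :=
    (hasDerivWithinAt_id x I).prodMk (hasDerivWithinAt_const x I y)
  exact h.comp_hasDerivWithinAt x h2 (fun z hz => Set.mk_mem_prod hz hy)

lemma aux_py {I : Set ℝ} {f : ℝ × ℝ → ℝ} {x y : ℝ} (hx : x ∈ I) (hy : y ∈ I)
    (hf : DifferentiableOn ℝ f (I ×ˢ I)) :
    HasDerivWithinAt (fun y => f (x, y)) (fderivWithin ℝ f (I ×ˢ I) (x, y) (0, 1)) I y := by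
  have h := (hf (x, y) (Set.mk_mem_prod hx hy)).hasFDerivWithinAt
  have h2 : HasDerivWithinAt (fun y : ℝ => (x, y)) ((0 : ℝ), (1 : ℝ)) I y :=
    (hasDerivWithinAt_const y I x).prodMk (hasDerivWithinAt_id y I)
  exact h.comp_hasDerivWithinAt y h2 (fun z hz => Set.mk_mem_prod hx hz)

/-- limit of one-variable difference quotients along a segment -/
lemma aux_slope {I : Set ℝ} {g : ℝ → ℝ} {g' t d : ℝ} (hd : d ≠ 0)
    (hmem : ∀ e ∈ Set.Ioc (0 : ℝ) 1, t + e * d ∈ I)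
    (hg : HasDerivWithinAt g g' I t) :
    Tendsto (fun e : ℝ => (g (t + e * d) - g t) / (e * d)) (𝓝[>] 0) (𝓝 g') := by
  rw [hasDerivWithinAt_iff_tendsto_slope] at hg
  have h1 : Tendsto (fun e : ℝ => t + e * d) (𝓝[>] 0) (𝓝[I \ {t}] t) := by
    apply tendsto_nhdsWithin_of_tendsto_nhds_of_eventually_within
    · have : Continuous (fun e : ℝ => t + e * d) := by fun_prop
      simpa using (this.tendsto 0).mono_left nhdsWithin_le_nhds
    · filter_upwards [Ioc_mem_nhdsGT (zero_lt_one : (0 : ℝ) < 1)] with e he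
      exact ⟨hmem e he, by simp [he.1.ne', hd]⟩
  refine (hg.comp h1).congr fun e => ?_
  simp [slope_def_field]

/-- limit of mixed second difference quotients -/
lemma aux_mixed {I : Set ℝ} (hI : I.OrdConnected) {k U V : ℝ → ℝ → ℝ}
    (hU : ∀ x ∈ I, ∀ y ∈ I, HasDerivWithinAt (fun y => k x y) (U x y) I y)
    (hV : ∀ x ∈ I, ∀ y ∈ I, HasDerivWithinAt (fun x => U x y) (V x y) I x)
    (hVc : ContinuousOn (fun p : ℝ × ℝ => V p.1 p.2) (I ×ˢ I))
    {s t c d : ℝ} (hs : s ∈ I) (ht : t ∈ I) (hc : c ≠ 0) (hd : d ≠ 0)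
    (hcm : ∀ e ∈ Set.Ioc (0 : ℝ) 1, s + e * c ∈ I)
    (hdm : ∀ e ∈ Set.Ioc (0 : ℝ) 1, t + e * d ∈ I) :
    Tendsto (fun e : ℝ => (k (s + e * c) (t + e * d) - k s (t + e * d)
      - k (s + e * c) t + k s t) / (e * c * (e * d))) (𝓝[>] 0) (𝓝 (V s t)) := by
  have ex : ∀ e : ℝ, ∃ p : ℝ × ℝ, e ∈ Set.Ioc (0 : ℝ) 1 →
      p.1 ∈ Set.uIcc s (s + e * c) ∧ p.2 ∈ Set.uIcc t (t + e * d) ∧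
      (k (s + e * c) (t + e * d) - k s (t + e * d)
      - k (s + e * c) t + k s t) / (e * c * (e * d)) = V p.1 p.2 := by
    intro e
    by_cases he : e ∈ Set.Ioc (0 : ℝ) 1
    swap
    · exact ⟨0, fun h => absurd h he⟩
    have hec : e * c ≠ 0 := mul_ne_zero he.1.ne' hc
    have hed : e * d ≠ 0 := mul_ne_zero he.1.ne' hd
    obtain ⟨η, hη, h1⟩ := aux_mvt hI (g := fun y => k (s + e * c) y - k s y)
      (g' := fun y => U (s + e * c) y - U s y)
      (fun y hy => (hU _ (hcm e he) y hy).sub (hU s hs y hy)) ht (hdm e he) (by simpa using hed.symm)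
    have hηI : η ∈ I := hI.uIcc_subset ht (hdm e he) hη
    obtain ⟨ξ, hξ, h2⟩ := aux_mvt hI (g := fun x => U x η) (g' := fun x => V x η)
      (fun x hx => hV x hx η hηI) hs (hcm e he) (by simpa using hec.symm)
    refine ⟨(ξ, η), fun _ => ⟨hξ, hη, ?_⟩⟩
    rw [div_eq_iff (mul_ne_zero hec hed)]
    simp only at h1 h2 ⊢
    rw [← h2] at h1
    linear_combination -h1
  choose p hp using ex
  have hev : ∀ᶠ e : ℝ in 𝓝[>] 0, e ∈ Set.Ioc (0 : ℝ) 1 :=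
    Ioc_mem_nhdsGT (zero_lt_one : (0 : ℝ) < 1)
  have sq : ∀ (r : ℝ → ℝ) (s c : ℝ),
      (∀ e ∈ Set.Ioc (0 : ℝ) 1, r e ∈ Set.uIcc s (s + e * c)) → Tendsto r (𝓝[>] 0) (𝓝 s) := by
    intro r s c hr
    rw [tendsto_iff_dist_tendsto_zero]
    have h0 : Tendsto (fun e : ℝ => |e * c|) (𝓝[>] 0) (𝓝 0) := by
      have : Continuous (fun e : ℝ => |e * c|) := by fun_prop
      simpa using (this.tendsto 0).mono_left nhdsWithin_le_nhds
    refine squeeze_zero' (Eventually.of_forall fun _ => dist_nonneg) ?_ h0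
    filter_upwards [hev] with e he
    have := Set.abs_sub_left_of_mem_uIcc (hr e he)
    simpa [Real.dist_eq] using this
  have hpt : Tendsto p (𝓝[>] 0) (𝓝[I ×ˢ I] (s, t)) := by
    apply tendsto_nhdsWithin_of_tendsto_nhds_of_eventually_within
    · exact (sq (fun e => (p e).1) s c fun e he => (hp e he).1).prodMk_nhds
        (sq (fun e => (p e).2) t d fun e he => (hp e he).2.1)
    · filter_upwards [hev] with e he
      exact ⟨hI.uIcc_subset hs (hcm e he) (hp e he).1, hI.uIcc_subset ht (hdm e he) (hp e he).2.1⟩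
  refine ((hVc (s, t) ⟨hs, ht⟩).tendsto.comp hpt).congr' ?_
  filter_upwards [hev] with e he
  exact ((hp e he).2.2).symm

/-- Let `k` be a `C²` symmetric positive semi-definite kernel on an interval
`I ⊆ ℝ`. For any points `t_1, ..., t_n ∈ I`, the `2n × 2n` matrix whose blocks
are built from `k`, its first partial derivatives and its mixed second partial
derivative at the pairs `(t_i, t_j)` — the Gram matrix prescribed for the pairs
`(z_{t_i}, z'_{t_i})` of a derivative Gaussian process — is symmetric positive
semi-definite. -/
theorem derivative_gp_gram_posSemidef {n : ℕ} (I : Set ℝ)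
    (hI : I.OrdConnected) (hInt : I.Nontrivial)
    (k : ℝ → ℝ → ℝ)
    (hsym : ∀ u ∈ I, ∀ v ∈ I, k u v = k v u)
    (hpsd : ∀ (N : ℕ) (s : Fin N → ℝ), (∀ i, s i ∈ I) → ∀ c : Fin N → ℝ,
      0 ≤ ∑ i, ∑ j, c i * c j * k (s i) (s j))
    (hk : ContDiffOn ℝ 2 (fun p : ℝ × ℝ => k p.1 p.2) (I ×ˢ I))
    (t : Fin n → ℝ) (ht : ∀ i, t i ∈ I) :
    (Matrix.of (fun p q : Fin n ⊕ Fin n =>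
      match p, q with
      | .inl i, .inl j => k (t i) (t j)
      | .inl i, .inr j => derivWithin (fun y => k (t i) y) I (t j)
      | .inr i, .inl j => derivWithin (fun x => k x (t j)) I (t i)
      | .inr i, .inr j =>
          derivWithin (fun x => derivWithin (fun y => k x y) I (t j)) I (t i))).PosSemidef := by
  have huI := aux_unique hI hInt
  have huS : UniqueDiffOn ℝ (I ×ˢ I) := huI.prod huI
  set f : ℝ × ℝ → ℝ := fun p => k p.1 p.2 with hf
  have hfd : DifferentiableOn ℝ f (I ×ˢ I) := hk.differentiableOn (by norm_num)
  let U : ℝ → ℝ → ℝ := fun x y => fderivWithin ℝ f (I ×ˢ I) (x, y) (0, 1)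
  let X : ℝ → ℝ → ℝ := fun x y => fderivWithin ℝ f (I ×ˢ I) (x, y) (1, 0)
  let Uf : ℝ × ℝ → ℝ := fun p => fderivWithin ℝ f (I ×ˢ I) p (0, 1)
  have hUC : ContDiffOn ℝ 1 Uf (I ×ˢ I) :=
    (hk.fderivWithin huS (m := 1) (by norm_num)).clm_apply contDiffOn_const
  have hUd : DifferentiableOn ℝ Uf (I ×ˢ I) := hUC.differentiableOn (by norm_num)
  let V : ℝ → ℝ → ℝ := fun x y => fderivWithin ℝ Uf (I ×ˢ I) (x, y) (1, 0)
  have hVc : ContinuousOn (fun p : ℝ × ℝ => V p.1 p.2) (I ×ˢ I) :=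
    (hUC.continuousOn_fderivWithin huS (by norm_num)).clm_apply continuousOn_const
  have hU : ∀ x ∈ I, ∀ y ∈ I, HasDerivWithinAt (fun y => k x y) (U x y) I y :=
    fun x hx y hy => aux_py hx hy hfd
  have hX : ∀ x ∈ I, ∀ y ∈ I, HasDerivWithinAt (fun x => k x y) (X x y) I x :=
    fun x hx y hy => aux_px hx hy hfd
  have hV : ∀ x ∈ I, ∀ y ∈ I, HasDerivWithinAt (fun x => U x y) (V x y) I x :=
    fun x hx y hy => aux_px (f := Uf) hx hy hUd
  -- directions
  have hdir : ∀ i, ∃ d : ℝ, d ≠ 0 ∧ ∀ e ∈ Set.Ioc (0 : ℝ) 1, t i + e * d ∈ I := by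
    intro i
    obtain ⟨w, hw, hne⟩ := hInt.exists_ne (t i)
    refine ⟨w - t i, sub_ne_zero.2 hne, fun e he => ?_⟩
    have := hI.convex.add_smul_sub_mem (ht i) hw ⟨he.1.le, he.2⟩
    simpa using this
  choose d hd0 hd using hdir
  let A : ℝ → Matrix (Fin n ⊕ Fin n) (Fin n ⊕ Fin n) ℝ := fun e => Matrix.of (fun p q =>
    match p, q with
    | .inl i, .inl j => k (t i) (t j)
    | .inl i, .inr j => (k (t i) (t j + e * d j) - k (t i) (t j)) / (e * d j)
    | .inr i, .inl j => (k (t i + e * d i) (t j) - k (t i) (t j)) / (e * d i)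
    | .inr i, .inr j => (k (t i + e * d i) (t j + e * d j) - k (t i) (t j + e * d j)
      - k (t i + e * d i) (t j) + k (t i) (t j)) / (e * d i * (e * d j)))
  set M : Matrix (Fin n ⊕ Fin n) (Fin n ⊕ Fin n) ℝ := Matrix.of (fun p q =>
      match p, q with
      | .inl i, .inl j => k (t i) (t j)
      | .inl i, .inr j => derivWithin (fun y => k (t i) y) I (t j)
      | .inr i, .inl j => derivWithin (fun x => k x (t j)) I (t i)
      | .inr i, .inr j =>
          derivWithin (fun x => derivWithin (fun y => k x y) I (t j)) I (t i)) with hM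
  have hev : ∀ᶠ e : ℝ in 𝓝[>] 0, e ∈ Set.Ioc (0 : ℝ) 1 :=
    Ioc_mem_nhdsGT (zero_lt_one : (0 : ℝ) < 1)
  have hlim : ∀ p q, Tendsto (fun e => A e p q) (𝓝[>] 0) (𝓝 (M p q)) := by
    rintro (i | i) (j | j)
    · exact tendsto_const_nhds
    · have h := hU (t i) (ht i) (t j) (ht j)
      have e1 : M (.inl i) (.inr j) = U (t i) (t j) := h.derivWithin (huI _ (ht j))
      rw [e1]
      exact aux_slope (hd0 j) (hd j) h
    · have h := hX (t i) (ht i) (t j) (ht j)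
      have e1 : M (.inr i) (.inl j) = X (t i) (t j) := h.derivWithin (huI _ (ht i))
      rw [e1]
      exact aux_slope (g := fun x => k x (t j)) (hd0 i) (hd i) h
    · have e1 : M (.inr i) (.inr j) = V (t i) (t j) := by
        have h := hV (t i) (ht i) (t j) (ht j)
        refine HasDerivWithinAt.derivWithin ?_ (huI _ (ht i))
        refine h.congr_of_mem (fun x hx => ?_) (ht i)
        exact (hU x hx (t j) (ht j)).derivWithin (huI _ (ht j))
      rw [e1]
      exact aux_mixed hI hU hV hVc (ht i) (ht j) (hd0 i) (hd0 j) (hd i) (hd j)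
  have hAsym : ∀ e ∈ Set.Ioc (0 : ℝ) 1, ∀ p q, A e p q = A e q p := by
    intro e he
    have hm := fun i => hd i e he
    rintro (i | i) (j | j)
    · exact hsym _ (ht i) _ (ht j)
    · simp only [A, Matrix.of_apply]
      rw [hsym _ (ht i) _ (hm j), hsym _ (ht i) _ (ht j)]
    · simp only [A, Matrix.of_apply]
      rw [hsym _ (hm i) _ (ht j), hsym _ (ht i) _ (ht j)]
    · simp only [A, Matrix.of_apply]
      rw [hsym _ (hm i) _ (hm j), hsym _ (ht i) _ (hm j), hsym _ (hm i) _ (ht j),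
        hsym _ (ht i) _ (ht j), mul_comm (e * d i)]
      ring
  have hpsd' : ∀ (s : Fin n ⊕ Fin n → ℝ), (∀ i, s i ∈ I) → ∀ c : Fin n ⊕ Fin n → ℝ,
      0 ≤ ∑ i, ∑ j, c i * c j * k (s i) (s j) := by
    intro s hs c
    have h := hpsd (n + n) (s ∘ finSumFinEquiv.symm) (fun i => hs _) (c ∘ finSumFinEquiv.symm)
    rw [← finSumFinEquiv.sum_comp] at h
    simp_rw [← finSumFinEquiv.sum_comp (fun j => (c ∘ finSumFinEquiv.symm) _ *
      (c ∘ finSumFinEquiv.symm) j * k _ ((s ∘ finSumFinEquiv.symm) j))] at h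
    simpa only [Function.comp_apply, Equiv.symm_apply_apply] using h
  have hApos : ∀ e ∈ Set.Ioc (0 : ℝ) 1, ∀ x : Fin n ⊕ Fin n → ℝ,
      0 ≤ ∑ p, ∑ q, x p * x q * A e p q := by
    intro e he x
    have h := hpsd' (Sum.elim t (fun i => t i + e * d i))
      (by rintro (i | i); exacts [ht i, hd i e he])
      (Sum.elim (fun i => x (.inl i) - x (.inr i) / (e * d i)) (fun i => x (.inr i) / (e * d i)))
    refine h.trans_eq ?_
    simp only [Fintype.sum_sum_type, Sum.elim_inl, Sum.elim_inr, ← Finset.sum_add_distrib]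
    refine Finset.sum_congr rfl fun i _ => Finset.sum_congr rfl fun j _ => ?_
    simp only [A, Matrix.of_apply]
    have h1 : e * d i ≠ 0 := mul_ne_zero he.1.ne' (hd0 i)
    have h2 : e * d j ≠ 0 := mul_ne_zero he.1.ne' (hd0 j)
    generalize e * d i = u at *
    generalize e * d j = v at *
    field_simp
    ring
  refine Matrix.PosSemidef.of_dotProduct_mulVec_nonneg ?_ ?_
  · ext p q
    rw [Matrix.conjTranspose_apply, star_trivial]
    refine tendsto_nhds_unique (hlim q p) ((hlim p q).congr' ?_)
    filter_upwards [hev] with e he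
    exact hAsym e he p q
  · intro x
    have hq : star x ⬝ᵥ M *ᵥ x = ∑ p, ∑ q, x p * x q * M p q := by
      simp only [dotProduct, mulVec, star_trivial, Finset.mul_sum]
      refine Finset.sum_congr rfl fun i _ => Finset.sum_congr rfl fun j _ => ?_
      ring
    rw [hq]
    refine ge_of_tendsto (tendsto_finsetSum _ fun p _ => tendsto_finsetSum _ fun q _ =>
      (hlim p q).const_mul (x p * x q)) ?_
    filter_upwards [hev] with e he
    exact hApos e he x
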